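/- arXiv:2503.11355 — 12 statements merged into one kernel-verified Lean document; each statement's English description precedes it below -/
import Mathlib

section
/- Let n be a positive integer and let H be the n×n Hilbert matrix, with entries H i j = 1/(i+j-1) for 1 ≤ i, j ≤ n (as a matrix over ℚ or ℝ). Then H is invertible, and the entries of its inverse are given by (H⁻¹) i j = (-1)^(i+j) · (i+j-1) · C(n+i-1, n-j) · C(n+j-1, n-i) · C(i+j-2, i-1)², where C(a,b) denotes the binomial coefficient. -/
open Finset Polynomial in
/-- The interpolation formula for `∏ m ∈ range n \ {j}, (X + m + 1)` at the nodes `0, …, n - 1`,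
evaluated at `-(i + 1)`. -/
theorem sum_nodalWeight_mul_prod_erase_div (n i j : ℕ) (hj : j < n) :
    (∏ k ∈ range n, (-((i : ℚ) + 1) - k)) *
      ∑ k ∈ range n, Lagrange.nodalWeight (range n) (fun k : ℕ => (k : ℚ)) k *
        (-((i : ℚ) + 1) - k)⁻¹ * ∏ m ∈ (range n).erase j, ((k : ℚ) + m + 1) =
      ∏ m ∈ (range n).erase j, ((m : ℚ) - i) := by
  set g : ℚ[X] := ∏ m ∈ (range n).erase j, (X + C ((m : ℚ) + 1)) with hg
  have hdeg : g.degree < #(range n) := by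
    rw [hg, degree_prod]
    simp only [degree_X_add_C, sum_const, card_erase_of_mem (mem_range.2 hj), card_range,
      nsmul_eq_mul, mul_one]
    exact_mod_cast Nat.sub_lt (by omega) one_pos
  have hinj : Set.InjOn (fun k : ℕ => (k : ℚ)) (range n) := Nat.cast_injective.injOn
  have hne : ∀ k ∈ range n, -((i : ℚ) + 1) ≠ k := fun k _ h => by
    have : (0 : ℚ) < k + i + 1 := by positivity
    linarith
  have key := congrArg (eval (-((i : ℚ) + 1))) (Lagrange.eq_interpolate hinj hdeg)
  rw [Lagrange.eval_interpolate_not_at_node _ hne, Lagrange.eval_nodal] at key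
  simp only [hg, eval_prod, eval_add, eval_X, eval_C] at key
  simp only [add_assoc]
  rw [← key]
  exact prod_congr rfl fun m _ => by ring

open Finset in
theorem prod_range_erase_cast_sub (k d : ℕ) :
    ∏ m ∈ (range (k + 1 + d)).erase k, ((k : ℚ) - m) =
      (-1) ^ d * k.factorial * d.factorial := by
  induction d with
  | zero =>
    rw [add_zero, range_add_one, erase_insert (by simp), ← prod_range_reflect,
      ← prod_range_add_one_eq_factorial]
    push_cast
    simp only [pow_zero, Nat.factorial_zero, Nat.cast_one, one_mul, mul_one]
    refine prod_congr rfl fun m hm => ?_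
    have : m + 1 ≤ k := mem_range.1 hm
    rw [Nat.sub_sub, Nat.cast_sub (by omega)]
    push_cast
    ring
  | succ d ih =>
    rw [← add_assoc, range_add_one, erase_insert_of_ne (by omega),
      prod_insert (by simp), ih, Nat.factorial_succ]
    push_cast
    ring

open Finset in
theorem prod_range_cast_add_add_one (n k : ℕ) :
    ∏ m ∈ range n, ((k : ℚ) + m + 1) = (n + k).factorial / k.factorial := by
  rw [eq_div_iff (by positivity), mul_comm, add_comm n k, ← Nat.factorial_mul_ascFactorial,
    Nat.ascFactorial_eq_prod_range]
  push_cast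
  congr 1
  exact prod_congr rfl fun m _ => by ring

/-- `(n + k)! / (k!² (n - 1 - k)!)`, the coefficient through which the inverse Hilbert matrix
factors in Cauchy form. -/
def hilbertCoeff (n k : ℕ) : ℚ :=
  (n + k).factorial / (k.factorial ^ 2 * (n - 1 - k).factorial)

theorem hilbertCoeff_ne_zero (n k : ℕ) : hilbertCoeff n k ≠ 0 := by
  unfold hilbertCoeff
  positivity

theorem hilbert_inverse_entry_eq (n k j : ℕ) (hk : k < n) (hj : j < n) :
    (-1 : ℚ) ^ ((k + 1) + (j + 1)) * ((k + j + 1 : ℕ) : ℚ) *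
      ((Nat.choose (n + k) (n - j - 1) : ℕ) : ℚ) *
      ((Nat.choose (n + j) (n - k - 1) : ℕ) : ℚ) *
      ((Nat.choose (k + j) k : ℕ) : ℚ) ^ 2 =
    (-1) ^ (k + j) * hilbertCoeff n k * hilbertCoeff n j / (k + j + 1) := by
  rw [Nat.cast_choose ℚ (by omega : n - j - 1 ≤ n + k),
    Nat.cast_choose ℚ (by omega : n - k - 1 ≤ n + j), Nat.cast_choose ℚ (by omega : k ≤ k + j),
    show n + k - (n - j - 1) = k + j + 1 by omega, show n + j - (n - k - 1) = k + j + 1 by omega,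
    show k + j - k = j by omega, Nat.factorial_succ, hilbertCoeff, hilbertCoeff,
    show n - 1 - k = n - k - 1 by omega, show n - 1 - j = n - j - 1 by omega]
  push_cast
  field_simp
  ring

open Finset in
theorem sum_hilbertCoeff_div (n i j : ℕ) (hi : i < n) (hj : j < n) :
    ∑ k ∈ range n, (-1) ^ k * hilbertCoeff n k / ((i + k + 1) * (k + j + 1)) =
      if i = j then (-1) ^ j / hilbertCoeff n j else 0 := by
  have hw : ∀ k ∈ range n, (-1 : ℚ) ^ k * hilbertCoeff n k / ((i + k + 1) * (k + j + 1)) =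
      (-1) ^ n * (Lagrange.nodalWeight (range n) (fun k : ℕ => (k : ℚ)) k *
        (-((i : ℚ) + 1) - k)⁻¹ * ∏ m ∈ (range n).erase j, ((k : ℚ) + m + 1)) := by
    intro k hk
    obtain ⟨d, rfl⟩ := Nat.exists_eq_add_of_le (show k + 1 ≤ n from mem_range.1 hk)
    have hprod := prod_range_cast_add_add_one (k + 1 + d) k
    rw [← mul_prod_erase _ _ (mem_range.2 hj)] at hprod
    have hkj : (k : ℚ) + j + 1 ≠ 0 := by positivity
    have hik : (i : ℚ) + k + 1 ≠ 0 := by positivity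
    rw [eq_div_of_mul_eq hkj ((mul_comm _ _).trans hprod), Lagrange.nodalWeight, prod_inv_distrib,
      prod_range_erase_cast_sub, hilbertCoeff, show k + 1 + d - 1 - k = d by omega,
      show -((i : ℚ) + 1) - k = -(i + k + 1) by ring, inv_neg]
    field_simp
    ring
  rw [sum_congr rfl hw, ← mul_sum]
  have key := sum_nodalWeight_mul_prod_erase_div n i j hj
  have hnodal : ∏ k ∈ range n, (-((i : ℚ) + 1) - k) =
      (-1) ^ n * ((n + i).factorial / i.factorial) := by
    rw [← prod_range_cast_add_add_one]
    conv_rhs => rw [← card_range n, ← prod_const, card_range, ← prod_mul_distrib]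
    exact prod_congr rfl fun m _ => by ring
  rw [hnodal, mul_right_comm] at key
  have hfac : ((n + i).factorial / i.factorial : ℚ) ≠ 0 := by positivity
  rw [eq_div_of_mul_eq hfac key]
  split_ifs with hij
  · subst hij
    obtain ⟨d, rfl⟩ := Nat.exists_eq_add_of_le (show i + 1 ≤ n from hi)
    have hneg : ∏ m ∈ (range (i + 1 + d)).erase i, ((m : ℚ) - i) =
        (-1) ^ (i + d) * ∏ m ∈ (range (i + 1 + d)).erase i, ((i : ℚ) - m) := by
      have hc : #((range (i + 1 + d)).erase i) = i + d := by
        rw [card_erase_of_mem (mem_range.2 hi), card_range]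
        omega
      rw [← hc, ← prod_const, ← prod_mul_distrib]
      exact prod_congr rfl fun m _ => by ring
    have hd : ((-1 : ℚ) ^ d) * (-1) ^ d = 1 := by rw [← mul_pow]; simp
    rw [hneg, prod_range_erase_cast_sub, hilbertCoeff, show i + 1 + d - 1 - i = d by omega,
      pow_add]
    field_simp
    linear_combination hd
  · rw [prod_eq_zero (mem_erase.2 ⟨hij, mem_range.2 hi⟩) (sub_self _), zero_div]

/-- The `n × n` Hilbert matrix over `ℚ`, with (1-based) entries `1/(i+j-1)`. -/
theorem hilbert_inverse_entries (n : ℕ) (hn : 0 < n)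
    (H : Matrix (Fin n) (Fin n) ℚ)
    (hH : ∀ i j, H i j = 1 / ((i.1 + j.1 + 1 : ℕ) : ℚ)) :
    IsUnit H ∧
    ∀ i j : Fin n, H⁻¹ i j =
      (-1 : ℚ) ^ ((i.1 + 1) + (j.1 + 1)) * ((i.1 + j.1 + 1 : ℕ) : ℚ) *
      ((Nat.choose (n + i.1) (n - j.1 - 1) : ℕ) : ℚ) *
      ((Nat.choose (n + j.1) (n - i.1 - 1) : ℕ) : ℚ) *
      ((Nat.choose (i.1 + j.1) i.1 : ℕ) : ℚ) ^ 2 := by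
  let M : Matrix (Fin n) (Fin n) ℚ := fun i j =>
    (-1) ^ (i.1 + j.1) * hilbertCoeff n i * hilbertCoeff n j / (i.1 + j.1 + 1)
  have hM : H * M = 1 := by
    ext i j
    have hterm : ∀ k : Fin n, H i k * M k j = (-1) ^ j.1 * hilbertCoeff n j *
        ((-1) ^ k.1 * hilbertCoeff n k / ((i.1 + k.1 + 1) * (k.1 + j.1 + 1))) := by
      intro k
      simp only [hH, M]
      push_cast
      field_simp
      ring
    rw [Matrix.mul_apply, Finset.sum_congr rfl fun k _ => hterm k, ← Finset.mul_sum,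
      Fin.sum_univ_eq_sum_range (fun k : ℕ => (-1 : ℚ) ^ k * hilbertCoeff n k /
        ((i.1 + k + 1) * (k + j.1 + 1))), sum_hilbertCoeff_div n i j i.2 j.2, Matrix.one_apply]
    simp only [Fin.ext_iff]
    split_ifs
    · have hj : ((-1 : ℚ) ^ j.1) * (-1) ^ j.1 = 1 := by rw [← mul_pow]; simp
      have hc := hilbertCoeff_ne_zero n j
      field_simp
      linear_combination hj
    · rw [mul_zero]
  refine ⟨IsUnit.of_mul_eq_one _ hM, fun i j => ?_⟩
  rw [Matrix.inv_eq_right_inv hM, hilbert_inverse_entry_eq n i j i.2 j.2]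
end

section
/- Let n be a positive integer and let H be the n×n Hilbert matrix over ℚ, with entries H i j = 1/(i+j-1). Then every entry of H⁻¹ is an integer, i.e., the inverse of the Hilbert matrix has integer entries. -/
open Polynomial in
/-- Alternating binomial sums of reciprocals of an arithmetic progression. -/
theorem sum_neg_one_pow_mul_choose_mul_inv (m : ℕ) {a : ℚ} (ha : 0 < a) :
    ∑ k ∈ Finset.range (m + 1), (-1 : ℚ) ^ k * m.choose k * (k + a)⁻¹ =
      m.factorial / (ascPochhammer ℚ (m + 1)).eval a := by
  induction m generalizing a with
  | zero => simp
  | succ m ih =>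
    have hsplit : ∑ k ∈ Finset.range (m + 2), (-1 : ℚ) ^ k * (m + 1).choose k * (k + a)⁻¹ =
        ∑ k ∈ Finset.range (m + 1), (-1 : ℚ) ^ k * m.choose k * (k + a)⁻¹ -
        ∑ k ∈ Finset.range (m + 1), (-1 : ℚ) ^ k * m.choose k * (k + (a + 1))⁻¹ := by
      have hext : ∑ k ∈ Finset.range (m + 1), (-1 : ℚ) ^ k * m.choose k * (k + a)⁻¹ =
          ∑ k ∈ Finset.range (m + 2), (-1 : ℚ) ^ k * m.choose k * (k + a)⁻¹ := by
        rw [Finset.sum_range_succ _ (m + 1)]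
        simp
      rw [hext, Finset.sum_range_succ', Finset.sum_range_succ' _ (m + 1), add_sub_right_comm,
        ← Finset.sum_sub_distrib]
      congr 1
      · refine Finset.sum_congr rfl fun k _ => ?_
        rw [Nat.choose_succ_succ]
        push_cast
        rw [show (k : ℚ) + 1 + a = k + (a + 1) by ring]
        ring
      · simp
    rw [hsplit, ih ha, ih (by linarith : (0 : ℚ) < a + 1)]
    have hP := ascPochhammer_pos m (a + 1) (by linarith)
    have hleft : (ascPochhammer ℚ (m + 1)).eval a = a * (ascPochhammer ℚ m).eval (a + 1) := by
      rw [ascPochhammer_succ_left]; simp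
    have hleft' : (ascPochhammer ℚ (m + 1 + 1)).eval a =
        a * (ascPochhammer ℚ m).eval (a + 1) * (a + (m + 1)) := by
      rw [ascPochhammer_succ_eval, hleft]; push_cast; ring
    have hpos : 0 < a + (m + 1) := by positivity
    have hpos' : 0 < a + 1 + m := by positivity
    rw [hleft, hleft', ascPochhammer_succ_eval, Nat.factorial_succ]
    push_cast
    field_simp
    ring

open Polynomial in
/-- Alternating binomial sums annihilate polynomials of degree less than the order. -/
theorem sum_neg_one_pow_mul_choose_mul_eval_eq_zero {m : ℕ} {q : ℚ[X]} (hq : q.degree < m) :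
    ∑ k ∈ Finset.range (m + 1), (-1 : ℚ) ^ k * m.choose k * q.eval (k : ℚ) = 0 := by
  rcases eq_or_ne q 0 with rfl | hq0
  · simp
  have h := congrFun (fwdDiff_iter_eq_zero_of_degree_lt
    ((natDegree_lt_iff_degree_lt hq0).2 hq)) 0
  rw [fwdDiff_iter_eq_sum_shift] at h
  have h' := congrArg ((-1 : ℚ) ^ m * ·) h
  simp only [Finset.mul_sum, Pi.zero_apply, mul_zero] at h'
  rw [← h']
  refine Finset.sum_congr rfl fun k hk => ?_
  obtain ⟨d, rfl⟩ := Nat.exists_eq_add_of_le (Nat.lt_succ_iff.1 (Finset.mem_range.1 hk))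
  have hd : (-1 : ℚ) ^ d * (-1) ^ d = 1 := by rw [← mul_pow]; simp
  simp only [Nat.add_sub_cancel_left, zsmul_eq_mul, nsmul_eq_mul, mul_one, zero_add, pow_add]
  push_cast
  linear_combination (-(-1 : ℚ) ^ k * (k + d).choose k * q.eval (k : ℚ)) * hd

open Polynomial in
theorem sum_neg_one_pow_mul_choose_mul_eval_div {m : ℕ} {g : ℚ[X]} (hg : g.degree ≤ m)
    {a : ℚ} (ha : 0 < a) :
    ∑ k ∈ Finset.range (m + 1), (-1 : ℚ) ^ k * m.choose k * (g.eval (k : ℚ) / (k + a)) =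
      g.eval (-a) * m.factorial / (ascPochhammer ℚ (m + 1)).eval a := by
  obtain ⟨q, hq⟩ := X_sub_C_dvd_sub_C_eval (a := -a) (p := g)
  have hdeg : q.degree < m := by
    rcases eq_or_ne q 0 with rfl | hq0
    · simp
    have h1 : (g - C (g.eval (-a))).degree ≤ m :=
      (degree_sub_le _ _).trans (max_le hg (degree_C_le.trans (by exact_mod_cast m.zero_le)))
    rw [hq, degree_mul, degree_X_sub_C, degree_eq_natDegree hq0] at h1
    rw [degree_eq_natDegree hq0]
    have h2 : 1 + q.natDegree ≤ m := by exact_mod_cast h1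
    exact_mod_cast (by omega : q.natDegree < m)
  rw [mul_div_assoc, ← sum_neg_one_pow_mul_choose_mul_inv m ha, Finset.mul_sum, ← sub_eq_zero,
    ← Finset.sum_sub_distrib, ← sum_neg_one_pow_mul_choose_mul_eval_eq_zero hdeg]
  refine Finset.sum_congr rfl fun k _ => ?_
  have he := congrArg (eval (k : ℚ)) hq
  simp only [eval_sub, eval_C, eval_mul, eval_X, sub_neg_eq_add] at he
  have hk : (k : ℚ) + a ≠ 0 := by positivity
  field_simp
  linear_combination (m.choose k : ℚ) * he

/-- The coefficient of `x ^ k` in the shifted Legendre polynomial of degree `m`. -/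
def shiftedLegendreCoeff (m k : ℕ) : ℤ := (-1) ^ k * m.choose k * (m + k).choose m

theorem sum_shiftedLegendreCoeff_div (m j : ℕ) :
    ∑ k ∈ Finset.range (m + 1), (shiftedLegendreCoeff m k : ℚ) / ((j + k + 1 : ℕ) : ℚ) =
      (ascPochhammer ℚ m).eval (-j : ℚ) / (ascPochhammer ℚ (m + 1)).eval (j + 1 : ℚ) := by
  have hdeg : ((ascPochhammer ℚ m).comp (Polynomial.X + 1)).degree ≤ m := by
    refine Polynomial.degree_le_of_natDegree_le (Polynomial.natDegree_comp_le.trans ?_)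
    rw [ascPochhammer_natDegree, ← Polynomial.C_1, Polynomial.natDegree_X_add_C, mul_one]
  have h := sum_neg_one_pow_mul_choose_mul_eval_div hdeg (a := j + 1) (by positivity)
  have hm : (m.factorial : ℚ) ≠ 0 := by positivity
  rw [← mul_right_inj' hm, Finset.mul_sum]
  simp only [Polynomial.eval_comp, Polynomial.eval_add, Polynomial.eval_X,
    Polynomial.eval_one] at h
  rw [show -((j : ℚ) + 1) + 1 = -j by ring] at h
  rw [mul_div_assoc', mul_comm (m.factorial : ℚ) (Polynomial.eval _ _), ← h]
  refine Finset.sum_congr rfl fun k _ => ?_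
  have hc : (ascPochhammer ℚ m).eval ((k : ℚ) + 1) = m.factorial * (m + k).choose m := by
    have := Nat.ascFactorial_eq_factorial_mul_choose k m
    rw [← Nat.cast_succ, ← Nat.cast_ascFactorial, Nat.succ_eq_add_one, this, add_comm k m]
    push_cast
    rfl
  rw [hc, shiftedLegendreCoeff]
  push_cast
  rw [show (k : ℚ) + (j + 1) = j + k + 1 by ring]
  ring

theorem sum_shiftedLegendreCoeff_div_eq_zero {m j : ℕ} (h : j < m) :
    ∑ k ∈ Finset.range (m + 1), (shiftedLegendreCoeff m k : ℚ) / ((j + k + 1 : ℕ) : ℚ) = 0 := by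
  rw [sum_shiftedLegendreCoeff_div, ascPochhammer_eval_neg_eq_descPochhammer,
    descPochhammer_eval_coe_nat_of_lt h]
  simp

theorem shiftedLegendreCoeff_self_mul_sum_div (m : ℕ) :
    (shiftedLegendreCoeff m m : ℚ) *
      ∑ k ∈ Finset.range (m + 1), (shiftedLegendreCoeff m k : ℚ) / ((m + k + 1 : ℕ) : ℚ) =
      1 / (2 * m + 1) := by
  have hd : (descPochhammer ℚ m).eval (m : ℚ) = m.factorial := by
    rw [descPochhammer_eval_eq_descFactorial, Nat.descFactorial_self]
  have ha : (ascPochhammer ℚ m).eval ((m : ℚ) + 1) = m.factorial * (m + m).choose m := by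
    rw [← Nat.cast_succ, ← Nat.cast_ascFactorial, Nat.succ_eq_add_one,
      Nat.ascFactorial_eq_factorial_mul_choose]
    push_cast
    rfl
  have hs : (-1 : ℚ) ^ m * (-1) ^ m = 1 := by rw [← mul_pow]; simp
  have hm : (m.factorial : ℚ) ≠ 0 := by positivity
  have hc : ((m + m).choose m : ℚ) ≠ 0 := by
    exact_mod_cast (Nat.choose_pos (Nat.le_add_left m m)).ne'
  rw [sum_shiftedLegendreCoeff_div, ascPochhammer_eval_neg_eq_descPochhammer, hd,
    ascPochhammer_succ_eval, ha, shiftedLegendreCoeff, Nat.choose_self]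
  push_cast
  have h1 : (m : ℚ) + 1 + m ≠ 0 := by positivity
  have h2 : 2 * (m : ℚ) + 1 ≠ 0 := by positivity
  field_simp
  linear_combination (2 * (m : ℚ) + 1) * hs

/-- The matrix of coefficients of the first `n` shifted Legendre polynomials. -/
def shiftedLegendreMatrix (n : ℕ) : Matrix (Fin n) (Fin n) ℤ :=
  Matrix.of fun m k => shiftedLegendreCoeff m k

theorem shiftedLegendreCoeff_eq_zero {m k : ℕ} (h : m < k) : shiftedLegendreCoeff m k = 0 := by
  simp [shiftedLegendreCoeff, Nat.choose_eq_zero_of_lt h]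

open Matrix in
/-- Orthogonality of the shifted Legendre polynomials, as a diagonalization of the Hilbert
matrix. -/
theorem shiftedLegendreMatrix_mul_hilbert_mul_transpose {n : ℕ} {H : Matrix (Fin n) (Fin n) ℚ}
    (hH : ∀ i j, H i j = 1 / ((i.1 + j.1 + 1 : ℕ) : ℚ)) :
    (shiftedLegendreMatrix n).map (Int.castRingHom ℚ) * H *
      ((shiftedLegendreMatrix n).map (Int.castRingHom ℚ))ᵀ =
      diagonal fun m : Fin n => 1 / (2 * (m : ℚ) + 1) := by
  set L := (shiftedLegendreMatrix n).map (Int.castRingHom ℚ) with hL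
  have hLapp (m k : Fin n) : L m k = shiftedLegendreCoeff m k := rfl
  have hHL (j m : Fin n) : (H * Lᵀ) j m = ∑ k ∈ Finset.range (m.1 + 1),
      (shiftedLegendreCoeff m k : ℚ) / ((j.1 + k + 1 : ℕ) : ℚ) := by
    simp only [mul_apply, transpose_apply, hH, hLapp]
    rw [Finset.sum_subset (Finset.range_subset_range.2 (Nat.succ_le_of_lt m.2))
      fun k _ hk => by
        rw [shiftedLegendreCoeff_eq_zero (by simpa using hk)]; simp,
      ← Fin.sum_univ_eq_sum_range
        (fun k => (shiftedLegendreCoeff m k : ℚ) / ((j.1 + k + 1 : ℕ) : ℚ))]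
    exact Finset.sum_congr rfl fun k _ => by ring
  have hlow {l m : Fin n} (h : l ≤ m) : (L * H * Lᵀ) l m = L l l * (H * Lᵀ) l m := by
    rw [Matrix.mul_assoc, mul_apply]
    refine Finset.sum_eq_single l (fun j _ hj => ?_) (by simp)
    rcases lt_or_gt_of_ne hj with hj | hj
    · rw [hHL, sum_shiftedLegendreCoeff_div_eq_zero (lt_of_lt_of_le hj h), mul_zero]
    · rw [hLapp, shiftedLegendreCoeff_eq_zero hj, Int.cast_zero, zero_mul]
  have hupper {l m : Fin n} (h : l < m) : (L * H * Lᵀ) l m = 0 := by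
    rw [hlow h.le, hHL, sum_shiftedLegendreCoeff_div_eq_zero h, mul_zero]
  have hHt : Hᵀ = H := by
    ext i j
    rw [transpose_apply, hH, hH, add_comm j.1]
  have hsymm : (L * H * Lᵀ)ᵀ = L * H * Lᵀ := by
    rw [transpose_mul, transpose_mul, transpose_transpose, hHt, Matrix.mul_assoc]
  ext l m
  rcases lt_trichotomy l m with h | rfl | h
  · rw [hupper h, diagonal_apply_ne _ h.ne]
  · rw [hlow le_rfl, hHL, hLapp, shiftedLegendreCoeff_self_mul_sum_div, diagonal_apply_eq]
  · rw [← hsymm, transpose_apply, hupper h, diagonal_apply_ne _ h.ne']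

/-- Every entry of the inverse of the `n × n` Hilbert matrix over `ℚ` is an integer. -/
theorem hilbert_inverse_integer_entries (n : ℕ) (hn : 0 < n)
    (H : Matrix (Fin n) (Fin n) ℚ)
    (hH : ∀ i j, H i j = 1 / ((i.1 + j.1 + 1 : ℕ) : ℚ)) :
    ∀ i j : Fin n, ∃ k : ℤ, H⁻¹ i j = (k : ℚ) := by
  set L := shiftedLegendreMatrix n
  set D : Matrix (Fin n) (Fin n) ℤ := Matrix.diagonal fun m => 2 * (m : ℤ) + 1 with hD
  set φ := Int.castRingHom ℚ
  have hinv : L.map φ * H * (L.map φ).transpose * D.map φ = 1 := by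
    rw [shiftedLegendreMatrix_mul_hilbert_mul_transpose hH, hD,
      Matrix.diagonal_map (map_zero φ), Matrix.diagonal_mul_diagonal, ← Matrix.diagonal_one]
    congr 1
    ext m
    have : 2 * (m.1 : ℚ) + 1 ≠ 0 := by positivity
    simp [φ, this]
  have hHinv : H * (L.transpose * D * L).map φ = 1 := by
    rw [Matrix.map_mul, Matrix.map_mul, Matrix.transpose_map]
    rw [Matrix.mul_assoc, Matrix.mul_assoc, mul_eq_one_comm] at hinv
    simpa only [Matrix.mul_assoc] using hinv
  intro i j
  exact ⟨(L.transpose * D * L) i j, by rw [Matrix.inv_eq_right_inv hHinv]; rfl⟩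
end

section
/- Let n be a positive integer and let H be the n×n Hilbert matrix over ℝ, with entries H i j = 1/(i+j-1). Then H is symmetric and positive definite. -/
open Polynomial in
/-- The square of a nonzero real polynomial has positive integral over `[0, 1]`. -/
theorem Polynomial.integral_eval_sq_pos {p : ℝ[X]} (hp : p ≠ 0) :
    0 < ∫ t in (0 : ℝ)..1, p.eval t ^ 2 := by
  refine intervalIntegral.integral_pos one_pos (by fun_prop) (fun t _ => sq_nonneg _) ?_
  obtain ⟨c, hc, hroot⟩ :=
    (Set.Icc_infinite (zero_lt_one' ℝ)).exists_notMem_finset p.roots.toFinset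
  refine ⟨c, hc, sq_pos_of_ne_zero fun h => hroot ?_⟩
  simpa [hp] using h

/-- The Hilbert quadratic form is the integral over `[0, 1]` of the square of the polynomial
with the given coefficients. -/
theorem sum_mul_hilbert_eq_integral {n : ℕ} (x : Fin n → ℝ) :
    ∑ i, x i * ∑ j, 1 / ((i.1 + j.1 + 1 : ℕ) : ℝ) * x j =
      ∫ t in (0 : ℝ)..1,
        (∑ i, Polynomial.C (x i) * Polynomial.X ^ (i : ℕ)).eval t ^ 2 := by
  have expand (t : ℝ) : (∑ i, Polynomial.C (x i) * Polynomial.X ^ (i : ℕ)).eval t ^ 2 =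
      ∑ i, ∑ j, x i * x j * t ^ (i.1 + j.1) := by
    simp only [Polynomial.eval_finsetSum, Polynomial.eval_mul, Polynomial.eval_C,
      Polynomial.eval_pow, Polynomial.eval_X, sq, Finset.sum_mul_sum]
    refine Finset.sum_congr rfl fun i _ => Finset.sum_congr rfl fun j _ => ?_
    ring
  simp_rw [expand]
  rw [intervalIntegral.integral_finsetSum
    fun i _ => Continuous.intervalIntegrable (by fun_prop) _ _]
  refine Finset.sum_congr rfl fun i _ => ?_
  rw [intervalIntegral.integral_finsetSum
    fun j _ => Continuous.intervalIntegrable (by fun_prop) _ _, Finset.mul_sum]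
  refine Finset.sum_congr rfl fun j _ => ?_
  rw [intervalIntegral.integral_const_mul, integral_pow]
  push_cast
  simp
  ring

/-- The `n × n` Hilbert matrix over `ℝ` is symmetric and positive definite. -/
theorem hilbert_symm_posDef (n : ℕ) (hn : 0 < n)
    (H : Matrix (Fin n) (Fin n) ℝ)
    (hH : ∀ i j, H i j = 1 / ((i.1 + j.1 + 1 : ℕ) : ℝ)) :
    H.IsSymm ∧ H.PosDef := by
  have hsymm : H.IsSymm := Matrix.IsSymm.ext fun i j => by rw [hH, hH, add_comm j.1]
  refine ⟨hsymm, Matrix.PosDef.of_dotProduct_mulVec_pos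
    (by rwa [Matrix.IsHermitian, Matrix.conjTranspose_eq_transpose_of_trivial]) fun x hx => ?_⟩
  simp only [star_trivial, dotProduct, Matrix.mulVec, hH]
  rw [sum_mul_hilbert_eq_integral]
  refine Polynomial.integral_eval_sq_pos fun hp => hx (funext fun i => ?_)
  simpa [Polynomial.finsetSum_coeff, Polynomial.coeff_X_pow, Fin.val_inj] using
    congrArg (fun p => p.coeff i) hp
end

section
/- Let n be a positive integer and let H be the n×n Hilbert matrix over ℝ, with entries H i j = 1/(i+j-1). Then H is totally positive: for every k and every pair of strictly increasing index sequences i₁ < ⋯ < i_k and j₁ < ⋯ < j_k in {1,…,n}, the determinant of the k×k submatrix (H i_r j_s)_{r,s} is strictly positive. -/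
/-- A Cauchy matrix `1 / (x i + y j)` with strictly increasing parameters and positive
denominators has positive determinant. -/
theorem det_cauchy_pos {k : ℕ} (x y : Fin k → ℝ) (hx : StrictMono x) (hy : StrictMono y)
    (hxy : ∀ i j, 0 < x i + y j) :
    0 < (Matrix.of fun i j => 1 / (x i + y j)).det := by
  induction k with
  | zero => simp
  | succ k ih =>
    have hminor := ih (x ∘ Fin.succ) (y ∘ Fin.succ) (hx.comp (Fin.strictMono_succ))
      (hy.comp (Fin.strictMono_succ)) fun i j => hxy _ _
    set A : Matrix (Fin (k + 1)) (Fin (k + 1)) ℝ := Matrix.of fun i j => 1 / (x i + y j) with hA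
    let c : Fin (k + 1) → ℝ := Fin.cons 0 fun i => (x 0 + y 0) / (x i.succ + y 0)
    let B : Matrix (Fin (k + 1)) (Fin (k + 1)) ℝ := Matrix.of fun i j => A i j - c i * A 0 j
    have hAB : A.det = B.det :=
      Matrix.det_eq_of_forall_row_eq_smul_add_const c 0 rfl fun i j => by simp [B, c]
    have hB00 : B 0 0 = 1 / (x 0 + y 0) := by simp [B, c, hA]
    have hBcol (i : Fin k) : B i.succ 0 = 0 := by
      have h₀ := (hxy 0 0).ne'
      have h₁ := (hxy i.succ 0).ne'
      simp only [B, c, hA, Matrix.of_apply, Fin.cons_succ]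
      field_simp
      ring
    have hBminor : B.submatrix Fin.succ Fin.succ = Matrix.of fun i j : Fin k =>
        (x i.succ - x 0) / (x i.succ + y 0) * (Matrix.of fun i j : Fin k =>
          (y j.succ - y 0) / (x 0 + y j.succ) *
            (Matrix.of fun i j : Fin k => 1 / (x i.succ + y j.succ)) i j) i j := by
      ext i j
      have h₁ := (hxy i.succ 0).ne'
      have h₂ := (hxy 0 j.succ).ne'
      have h₃ := (hxy i.succ j.succ).ne'
      simp only [B, c, hA, Matrix.submatrix_apply, Matrix.of_apply, Fin.cons_succ]
      field_simp
      ring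
    rw [hAB, Matrix.det_succ_column_zero, Fin.sum_univ_succ]
    simp only [hBcol, hB00, mul_zero, zero_mul, Finset.sum_const_zero, add_zero, Fin.val_zero,
      pow_zero, one_mul, Fin.succAbove_zero]
    rw [hBminor, Matrix.det_mul_column, Matrix.det_mul_row]
    refine mul_pos (one_div_pos.2 (hxy 0 0)) (mul_pos ?_ (mul_pos ?_ hminor))
    · exact Finset.prod_pos fun i _ => div_pos (sub_pos.2 (hx i.succ_pos)) (hxy _ _)
    · exact Finset.prod_pos fun j _ => div_pos (sub_pos.2 (hy j.succ_pos)) (hxy _ _)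

/-- The `n × n` Hilbert matrix over `ℝ` is totally positive: every minor obtained
by selecting strictly increasing sequences of rows and columns is strictly positive. -/
theorem hilbert_totally_positive (n : ℕ) (hn : 0 < n)
    (H : Matrix (Fin n) (Fin n) ℝ)
    (hH : ∀ i j, H i j = 1 / ((i.1 + j.1 + 1 : ℕ) : ℝ)) :
    ∀ (k : ℕ) (r c : Fin k → Fin n), StrictMono r → StrictMono c →
      0 < (H.submatrix r c).det := by
  intro k r c hr hc
  have key := det_cauchy_pos (fun i => ((r i).1 : ℝ)) (fun j => ((c j).1 : ℝ) + 1)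
    (fun i j hij => Nat.cast_lt.2 (hr hij))
    (fun i j hij => add_lt_add_left (Nat.cast_lt.2 (hc hij)) 1) fun i j => by positivity
  convert key using 2
  ext i j
  simp [hH, add_assoc]
end

section
/- Let n be a positive integer and let H be the n×n Hilbert matrix over ℚ (or ℝ), with entries H i j = 1/(i+j-1). Then det H = (∏_{1 ≤ i < j ≤ n} (j-i)²) / (∏_{i=1}^n ∏_{j=1}^n (i+j-1)). In particular det H > 0. -/
open Finset in
/-- The Cauchy determinant formula. -/
theorem Matrix.det_cauchy_eq_div {K : Type*} [Field K] {n : ℕ} (x y : Fin n → K)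
    (hxy : ∀ i j, x i + y j ≠ 0) :
    (Matrix.of fun i j => 1 / (x i + y j)).det =
      (∏ i, ∏ j ∈ Ioi i, (x j - x i) * (y j - y i)) / ∏ i, ∏ j, (x i + y j) := by
  induction n with
  | zero => simp
  | succ n ih =>
    set C : Matrix (Fin (n + 1)) (Fin (n + 1)) K := Matrix.of fun i j => 1 / (x i + y j) with hC
    -- The first row is used to clear the first column.
    let c : Fin (n + 1) → K := Fin.cons 0 fun i => (x 0 + y 0) / (x i.succ + y 0)
    let B : Matrix (Fin (n + 1)) (Fin (n + 1)) K := Matrix.of fun i j => C i j - c i * C 0 j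
    have hB : C.det = B.det :=
      Matrix.det_eq_of_forall_row_eq_smul_add_const c 0 rfl fun i j => by simp [B, c]
    have hcol (i : Fin n) : B i.succ 0 = 0 := by
      have h₁ := hxy 0 0
      have h₂ := hxy i.succ 0
      simp only [B, c, hC, Matrix.of_apply, Fin.cons_succ]
      field_simp
      simp
    have hminor : B.submatrix Fin.succ Fin.succ = Matrix.of fun i j =>
        (x i.succ - x 0) / (x i.succ + y 0) * (Matrix.of fun i j : Fin n =>
          (y j.succ - y 0) / (x 0 + y j.succ) *
            (Matrix.of fun i j : Fin n => 1 / (x i.succ + y j.succ)) i j) i j := by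
      ext i j
      have h₁ := hxy i.succ j.succ
      have h₂ := hxy i.succ 0
      have h₃ := hxy 0 j.succ
      simp only [B, c, hC, Matrix.submatrix_apply, Matrix.of_apply, Fin.cons_succ]
      field_simp
      ring
    have hdet : B.det = B 0 0 * (B.submatrix Fin.succ Fin.succ).det := by
      rw [Matrix.det_succ_column_zero, Fin.sum_univ_succ]
      simp [hcol, Fin.succAbove_zero]
    have h00 : B 0 0 = 1 / (x 0 + y 0) := by simp [B, c, hC]
    rw [hB, hdet, hminor, h00, Matrix.det_mul_column, Matrix.det_mul_row,
      ih (fun i => x i.succ) (fun j => y j.succ) fun i j => hxy _ _]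
    simp only [Fin.prod_univ_succ, Fin.prod_Ioi_zero, Fin.prod_Ioi_succ, prod_mul_distrib,
      prod_inv_distrib, div_eq_mul_inv, mul_inv]
    ring

open Finset in
/-- The determinant of the `n × n` Hilbert matrix over `ℚ`:
`det H = (∏_{i<j} (j-i)²) / (∏_{i,j} (i+j-1))`, and in particular `det H > 0`. -/
theorem hilbert_determinant (n : ℕ) (hn : 0 < n)
    (H : Matrix (Fin n) (Fin n) ℚ)
    (hH : ∀ i j, H i j = 1 / ((i.1 + j.1 + 1 : ℕ) : ℚ)) :
    H.det =
      (∏ p ∈ univ.filter (fun p : Fin n × Fin n => p.1 < p.2),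
        (((p.2.1 : ℚ) - (p.1.1 : ℚ)) ^ 2)) /
      (∏ i : Fin n, ∏ j : Fin n, ((i.1 + j.1 + 1 : ℕ) : ℚ)) ∧
    0 < H.det := by
  have hdet : H.det =
      (∏ p ∈ univ.filter (fun p : Fin n × Fin n => p.1 < p.2),
        (((p.2.1 : ℚ) - (p.1.1 : ℚ)) ^ 2)) /
      (∏ i : Fin n, ∏ j : Fin n, ((i.1 + j.1 + 1 : ℕ) : ℚ)) := by
    have hcauchy : H = Matrix.of fun i j : Fin n => 1 / ((i.1 : ℚ) + ((j.1 : ℚ) + 1)) := by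
      ext i j
      simp [hH, add_assoc]
    rw [hcauchy, Matrix.det_cauchy_eq_div (fun i : Fin n => (i.1 : ℚ))
      (fun j : Fin n => (j.1 : ℚ) + 1) fun i j => by positivity]
    congr 1
    · rw [prod_filter, Fintype.prod_prod_type]
      refine prod_congr rfl fun i _ => ?_
      rw [← prod_filter, filter_lt_eq_Ioi]
      exact prod_congr rfl fun j _ => by ring
    · simp [add_assoc]
  refine ⟨hdet, hdet ▸ div_pos (prod_pos fun p hp => ?_) (by positivity)⟩
  have hlt : (p.1.1 : ℚ) < p.2.1 := by exact_mod_cast (mem_filter.mp hp).2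
  exact pow_pos (sub_pos.mpr hlt) 2
end

section
/- Let n be a positive integer and let A be the n×n Minij matrix over ℝ, with entries A i j = min(i, j). Then A is symmetric and positive definite. -/
/-- The upper triangular matrix of ones, the Cholesky factor of the Minij matrix. -/
def upperOnes (n : ℕ) : Matrix (Fin n) (Fin n) ℝ :=
  Matrix.of fun i j => if i ≤ j then 1 else 0

theorem det_upperOnes (n : ℕ) : (upperOnes n).det = 1 := by
  rw [Matrix.det_of_isUpperTriangular]
  · simp [upperOnes]
  · intro i j hij
    exact if_neg (not_le.mpr hij)

theorem conjTranspose_upperOnes_mul_self_apply {n : ℕ} (i j : Fin n) :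
    ((upperOnes n).conjTranspose * upperOnes n) i j = ((min (i.1 + 1) (j.1 + 1) : ℕ) : ℝ) := by
  have h : (Finset.univ.filter fun k : Fin n => k ≤ i ∧ k ≤ j) = Finset.Iic (min i j) := by
    ext k
    simp
  have hc : ((min i j : Fin n) : ℕ) + 1 = min (i.1 + 1) (j.1 + 1) := by
    rw [Fin.coe_min, Nat.add_min_add_right]
  simp only [Matrix.mul_apply, Matrix.conjTranspose_apply, upperOnes, Matrix.of_apply, star_trivial,
    ite_zero_mul_ite_zero, mul_one]
  rw [Finset.sum_boole, h, Fin.card_Iic, hc]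

/-- The `n × n` Minij matrix over `ℝ`, with entries `min(i,j)` (1-based),
is symmetric and positive definite. -/
theorem minij_symm_posDef (n : ℕ) (hn : 0 < n)
    (A : Matrix (Fin n) (Fin n) ℝ)
    (hA : ∀ i j, A i j = ((min (i.1 + 1) (j.1 + 1) : ℕ) : ℝ)) :
    A.IsSymm ∧ A.PosDef := by
  have hU : A = (upperOnes n).conjTranspose * upperOnes n := by
    ext i j
    rw [hA, conjTranspose_upperOnes_mul_self_apply]
  refine ⟨Matrix.IsSymm.ext fun i j => by rw [hA, hA, min_comm], ?_⟩
  rw [hU]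
  refine Matrix.PosDef.conjTranspose_mul_self _ (Matrix.mulVec_injective_of_isUnit ?_)
  rw [Matrix.isUnit_iff_isUnit_det, det_upperOnes]
  exact isUnit_one
end

section
/- Let n be a positive integer and let A be the n×n Minij matrix over ℝ, with entries A i j = min(i, j). Then the eigenvalues of A are exactly the n real numbers λᵢ = (1/4)·sec²(iπ/(2n+1)) for i = 1, 2, …, n; equivalently, for each i ∈ {1,…,n} the number (1/4)·(cos(iπ/(2n+1)))⁻² is a root of the characteristic polynomial of A, and these n numbers are pairwise distinct and exhaust the spectrum of A. -/
/-- Summation by parts against `min`, for a solution of a second-order recurrence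
vanishing at `0`. -/
theorem mul_sum_min_of_recurrence (w : ℕ → ℝ) (c : ℝ) (h0 : w 0 = 0)
    (hw : ∀ j, c * w (j + 1) = 2 * w (j + 1) - w j - w (j + 2)) (i n : ℕ) :
    c * ∑ j ∈ Finset.range n, ((min i (j + 1) : ℕ) : ℝ) * w (j + 1) =
      w (min i n) + ((min i n : ℕ) : ℝ) * (w n - w (n + 1)) := by
  induction n with
  | zero => simp [h0]
  | succ n ih =>
    rw [Finset.sum_range_succ, mul_add, ih]
    have h := hw n
    rcases le_or_gt i n with hi | hi
    · rw [min_eq_left hi, min_eq_left (by lia : i ≤ n + 1)]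
      linear_combination (i : ℝ) * h
    · rw [min_eq_right hi.le, min_eq_right (by lia : n + 1 ≤ i)]
      push_cast
      linear_combination ((n : ℝ) + 1) * h

theorem alternating_sin_recurrence (φ : ℝ) (j : ℕ) :
    4 * Real.cos φ ^ 2 * ((-1) ^ (j + 1) * Real.sin (2 * (j + 1 : ℕ) * φ)) =
      2 * ((-1) ^ (j + 1) * Real.sin (2 * (j + 1 : ℕ) * φ)) - (-1) ^ j * Real.sin (2 * j * φ) -
        (-1) ^ (j + 2) * Real.sin (2 * (j + 2 : ℕ) * φ) := by
  have h1 : 2 * (j : ℝ) * φ = 2 * (j + 1 : ℕ) * φ - 2 * φ := by push_cast; ring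
  have h2 : 2 * ((j + 2 : ℕ) : ℝ) * φ = 2 * (j + 1 : ℕ) * φ + 2 * φ := by push_cast; ring
  rw [h1, h2, Real.sin_sub, Real.sin_add, Real.cos_two_mul]
  ring

theorem Matrix.eq_of_det_smul_one_sub_eq_zero {n : ℕ} {K : Type*} [Field K]
    (A : Matrix (Fin n) (Fin n) K) {lam : Fin n → K} (hinj : Function.Injective lam)
    (hroot : ∀ i, (lam i • (1 : Matrix (Fin n) (Fin n) K) - A).det = 0) {μ : K}
    (hμ : (μ • (1 : Matrix (Fin n) (Fin n) K) - A).det = 0) : ∃ i, μ = lam i := by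
  classical
  have mem_roots (t : K) (ht : (t • (1 : Matrix (Fin n) (Fin n) K) - A).det = 0) :
      t ∈ A.charpoly.roots.toFinset := by
    rw [Multiset.mem_toFinset, Polynomial.mem_roots A.charpoly_monic.ne_zero, Polynomial.IsRoot,
      Matrix.eval_charpoly, ← ht, Matrix.scalar_apply, Matrix.smul_one_eq_diagonal]
  have hsub : Finset.univ.image lam ⊆ A.charpoly.roots.toFinset := by
    intro t ht
    obtain ⟨i, -, rfl⟩ := Finset.mem_image.1 ht
    exact mem_roots _ (hroot i)
  have hcard : A.charpoly.roots.toFinset.card ≤ (Finset.univ.image lam).card := by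
    rw [Finset.card_image_of_injective _ hinj, Finset.card_univ]
    calc A.charpoly.roots.toFinset.card ≤ A.charpoly.roots.card := Multiset.toFinset_card_le _
      _ ≤ A.charpoly.natDegree := Polynomial.card_roots' _
      _ = Fintype.card (Fin n) := A.charpoly_natDegree_eq_dim
  have hmem := mem_roots μ hμ
  rw [← Finset.eq_of_subset_of_card_le hsub hcard] at hmem
  obtain ⟨i, -, h⟩ := Finset.mem_image.1 hmem
  exact ⟨i, h.symm⟩


open Real in
/-- The eigenvalues of the `n × n` Minij matrix are exactly the `n` pairwise distinct
numbers `λᵢ = (1/4)·sec²(iπ/(2n+1))`, `i = 1, …, n`: each is a root of the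
characteristic polynomial `det(λI - A)`, they are pairwise distinct, and every
eigenvalue is of this form. -/
theorem minij_eigenvalues (n : ℕ) (hn : 0 < n)
    (A : Matrix (Fin n) (Fin n) ℝ)
    (hA : ∀ i j, A i j = ((min (i.1 + 1) (j.1 + 1) : ℕ) : ℝ))
    (lam : Fin n → ℝ)
    (hlam : ∀ i, lam i = (1 / 4) * ((Real.cos (((i.1 + 1 : ℕ) : ℝ) * π / (2 * n + 1))) ^ 2)⁻¹) :
    (∀ i : Fin n, (lam i • (1 : Matrix (Fin n) (Fin n) ℝ) - A).det = 0) ∧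
    Function.Injective lam ∧
    (∀ μ : ℝ, (μ • (1 : Matrix (Fin n) (Fin n) ℝ) - A).det = 0 → ∃ i, μ = lam i) := by
  set φ : Fin n → ℝ := fun i ↦ ((i.1 + 1 : ℕ) : ℝ) * π / (2 * n + 1) with hφ
  have hd : (0 : ℝ) < 2 * n + 1 := by positivity
  have hφ_pos (i) : 0 < φ i := by simp only [hφ]; positivity
  have hφ_lt (i) : φ i < π / 2 := by
    have hi : ((i.1 + 1 : ℕ) : ℝ) ≤ n := by exact_mod_cast i.2
    simp only [hφ]
    rw [div_lt_div_iff₀ hd two_pos]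
    nlinarith [pi_pos]
  have hcos (i) : 0 < Real.cos (φ i) :=
    Real.cos_pos_of_mem_Ioo ⟨by linarith [hφ_pos i, pi_pos], hφ_lt i⟩
  have hlam' (i) : lam i = 1 / 4 * (Real.cos (φ i) ^ 2)⁻¹ := hlam i
  have hinj : Function.Injective lam := by
    intro i j hij
    rw [hlam', hlam', mul_right_inj' (by norm_num), inv_inj,
      pow_left_inj₀ (hcos i).le (hcos j).le two_ne_zero] at hij
    have h := Real.injOn_cos ⟨(hφ_pos i).le, by linarith [hφ_lt i, pi_pos]⟩
      ⟨(hφ_pos j).le, by linarith [hφ_lt j, pi_pos]⟩ hij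
    simp only [hφ] at h
    rw [div_left_inj' hd.ne', mul_left_inj' pi_ne_zero, Nat.cast_inj] at h
    exact Fin.ext (by lia)
  have hroot (i : Fin n) : (lam i • (1 : Matrix (Fin n) (Fin n) ℝ) - A).det = 0 := by
    set w : ℕ → ℝ := fun j ↦ (-1) ^ j * Real.sin (2 * j * φ i) with hw
    have hboundary : w n = w (n + 1) := by
      have harg : 2 * ((n + 1 : ℕ) : ℝ) * φ i =
          ((i.1 + 1 : ℕ) : ℝ) * (2 * π) - 2 * n * φ i := by
        simp only [hφ]
        field_simp
        push_cast
        ring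
      simp only [hw]
      rw [harg, Real.sin_nat_mul_two_pi_sub]
      ring
    refine Matrix.exists_mulVec_eq_zero_iff.1 ⟨fun j ↦ w (j.1 + 1), fun h ↦ ?_, ?_⟩
    · have h1 := congrFun h ⟨0, hn⟩
      have hs : 0 < Real.sin (2 * φ i) :=
        Real.sin_pos_of_pos_of_lt_pi (by linarith [hφ_pos i]) (by linarith [hφ_lt i])
      simp [hw, hs.ne'] at h1
    · ext k
      have hsum := mul_sum_min_of_recurrence w (4 * Real.cos (φ i) ^ 2) (by simp [hw])
        (alternating_sin_recurrence (φ i)) (k.1 + 1) n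
      rw [min_eq_left (by lia : k.1 + 1 ≤ n), hboundary, sub_self, mul_zero, add_zero,
        ← Fin.sum_univ_eq_sum_range
          (fun j ↦ ((min (k.1 + 1) (j + 1) : ℕ) : ℝ) * w (j + 1))] at hsum
      rw [Matrix.sub_mulVec, Matrix.smul_mulVec, Matrix.one_mulVec, Pi.sub_apply, Pi.smul_apply,
        smul_eq_mul, Matrix.mulVec, dotProduct, Pi.zero_apply]
      simp only [hA]
      rw [← hsum, hlam']
      have := (hcos i).ne'
      field_simp
      ring
  exact ⟨hroot, hinj, fun μ hμ ↦ A.eq_of_det_smul_one_sub_eq_zero hinj hroot hμ⟩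
end

section
/- Let n be a positive integer and let P be the n×n symmetric Pascal matrix over ℝ (or ℚ), with entries P i j = C(i+j-2, i-1), where C denotes the binomial coefficient. Then P is symmetric and positive definite. -/
/-- A diagonal form of Vandermonde's identity. -/
theorem Nat.add_choose_eq_sum_range_choose_mul_choose {i n : ℕ} (hi : i < n) (j : ℕ) :
    (i + j).choose i = ∑ k ∈ Finset.range n, i.choose k * j.choose k := by
  rw [Nat.add_choose_eq, ← Finset.Nat.sum_antidiagonal_swap,
    Finset.Nat.sum_antidiagonal_eq_sum_range_succ_mk]
  calc
    _ = ∑ k ∈ Finset.range (i + 1), i.choose k * j.choose k :=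
      Finset.sum_congr rfl fun k hk => by
        simp [Nat.choose_symm (Finset.mem_range_succ_iff.mp hk)]
    _ = _ := Finset.sum_subset (Finset.range_subset_range.mpr hi) fun k _ hk => by
        rw [Nat.choose_eq_zero_of_lt (by simpa using hk), zero_mul]

/-- The lower triangular Pascal matrix. -/
def lowerPascal (n : ℕ) : Matrix (Fin n) (Fin n) ℝ :=
  .of fun i j => (i.1.choose j.1 : ℝ)

theorem det_lowerPascal (n : ℕ) : (lowerPascal n).det = 1 := by
  rw [Matrix.det_of_isLowerTriangular]
  · simp [lowerPascal]
  · intro i j hij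
    simp only [lowerPascal, Matrix.of_apply, Nat.cast_eq_zero]
    exact Nat.choose_eq_zero_of_lt hij

theorem lowerPascal_mul_conjTranspose_apply (n : ℕ) (i j : Fin n) :
    (lowerPascal n * (lowerPascal n).conjTranspose) i j = ((i.1 + j.1).choose i.1 : ℝ) := by
  rw [Nat.add_choose_eq_sum_range_choose_mul_choose i.2, ← Fin.sum_univ_eq_sum_range]
  simp [lowerPascal, Matrix.mul_apply]

/-- The `n × n` symmetric Pascal matrix over `ℝ`, with (1-based) entries
`C(i+j-2, i-1)`, is symmetric and positive definite. -/
theorem pascal_symm_posDef (n : ℕ) (hn : 0 < n)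
    (P : Matrix (Fin n) (Fin n) ℝ)
    (hP : ∀ i j, P i j = ((Nat.choose (i.1 + j.1) i.1 : ℕ) : ℝ)) :
    P.IsSymm ∧ P.PosDef := by
  have hfac : P = lowerPascal n * (lowerPascal n).conjTranspose := by
    ext i j
    rw [hP, lowerPascal_mul_conjTranspose_apply]
  have hpos : P.PosDef := by
    rw [hfac]
    refine .mul_conjTranspose_self _ (Matrix.vecMul_injective_of_isUnit ?_)
    simp [Matrix.isUnit_iff_isUnit_det, det_lowerPascal]
  exact ⟨by simpa [Matrix.IsHermitian, Matrix.IsSymm] using hpos.isHermitian, hpos⟩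
end

section
/- Let n be a positive integer and let L be the n×n Lehmer matrix over ℝ, with entries L i j = min(i,j)/max(i,j). Then L is symmetric and positive definite. -/
theorem sum_range_odd_of_le {n m : ℕ} (h : m < n) :
    ∑ k ∈ Finset.range n, (if k ≤ m then (2 * k + 1 : ℝ) else 0) = (m + 1) ^ 2 := by
  have sum_odd : ∀ m : ℕ, ∑ k ∈ Finset.range m, (2 * k + 1 : ℝ) = m ^ 2 := by
    intro m
    induction m with
    | zero => simp
    | succ m ih => rw [Finset.sum_range_succ, ih]; push_cast; ring
  have hfilter : (Finset.range n).filter (fun k => k ≤ m) = Finset.range (m + 1) := by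
    ext k
    simp only [Finset.mem_filter, Finset.mem_range]
    omega
  rw [← Finset.sum_filter, hfilter, sum_odd]
  push_cast
  ring

/-- The upper triangular factor `B` in the factorization `Bᵀ D B` of the Lehmer matrix. -/
noncomputable def lehmerFactor (n : ℕ) : Matrix (Fin n) (Fin n) ℝ :=
  Matrix.of fun k i => if k ≤ i then ((i : ℝ) + 1)⁻¹ else 0

theorem det_lehmerFactor_ne_zero (n : ℕ) : (lehmerFactor n).det ≠ 0 := by
  have htri : (lehmerFactor n).BlockTriangular id := fun i j hij => by
    simp [lehmerFactor, not_le.mpr (show j < i from hij)]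
  rw [Matrix.det_of_isUpperTriangular htri, Finset.prod_ne_zero_iff]
  intro i _
  simp only [lehmerFactor, Matrix.of_apply, le_refl, if_true]
  positivity

theorem lehmerFactor_conjTranspose_mul_diagonal_mul_apply (n : ℕ) (i j : Fin n) :
    ((lehmerFactor n).conjTranspose * Matrix.diagonal (fun k : Fin n => (2 * (k : ℝ) + 1)) *
      lehmerFactor n) i j =
      ((min (i.1 + 1) (j.1 + 1) : ℕ) : ℝ) / ((max (i.1 + 1) (j.1 + 1) : ℕ) : ℝ) := by
  have hterm : ∀ k : Fin n, star (lehmerFactor n k i) * (2 * (k : ℝ) + 1) * lehmerFactor n k j =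
      (if (k : ℕ) ≤ min i.1 j.1 then (2 * (k : ℝ) + 1) else 0) *
        (((i : ℝ) + 1)⁻¹ * ((j : ℝ) + 1)⁻¹) := by
    intro k
    simp only [lehmerFactor, Matrix.of_apply, le_min_iff, Fin.val_fin_le, star_trivial]
    by_cases hi : k ≤ i <;> by_cases hj : k ≤ j <;> simp [hi, hj]
    ring
  rw [Matrix.mul_apply]
  simp only [Matrix.mul_diagonal, Matrix.conjTranspose_apply, hterm]
  rw [← Finset.sum_mul,
    Fin.sum_univ_eq_sum_range (fun k => if k ≤ min i.1 j.1 then (2 * (k : ℝ) + 1) else 0) n,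
    sum_range_odd_of_le (lt_of_le_of_lt (min_le_left _ _) i.2)]
  rcases le_total i.1 j.1 with h | h
  · rw [min_eq_left h, min_eq_left (by omega), max_eq_right (by omega)]
    push_cast
    field_simp
  · rw [min_eq_right h, min_eq_right (by omega), max_eq_left (by omega)]
    push_cast
    field_simp


/-- The `n × n` Lehmer matrix over `ℝ`, with (1-based) entries `min(i,j)/max(i,j)`,
is symmetric and positive definite. -/
theorem lehmer_symm_posDef (n : ℕ) (hn : 0 < n)
    (L : Matrix (Fin n) (Fin n) ℝ)
    (hL : ∀ i j, L i j =
      ((min (i.1 + 1) (j.1 + 1) : ℕ) : ℝ) / ((max (i.1 + 1) (j.1 + 1) : ℕ) : ℝ)) :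
    L.IsSymm ∧ L.PosDef := by
  refine ⟨Matrix.IsSymm.ext fun i j => by rw [hL, hL, min_comm, max_comm], ?_⟩
  have hfact : L = (lehmerFactor n).conjTranspose *
      Matrix.diagonal (fun k : Fin n => (2 * (k : ℝ) + 1)) * lehmerFactor n := by
    ext i j
    rw [hL, lehmerFactor_conjTranspose_mul_diagonal_mul_apply]
  rw [hfact]
  exact (Matrix.posDef_diagonal_iff.mpr fun k => by positivity).conjTranspose_mul_mul_same
    (Matrix.mulVec_injective_of_det_ne_zero (det_lehmerFactor_ne_zero n))
end

section
/- Let n be a positive integer and let G be the n×n GCD matrix over ℝ, with entries G i j = gcd(i, j). Then G is symmetric and positive definite. -/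
/-- The matrix with 1-based entries `1` if `j ∣ i` and `0` otherwise. -/
def divisorMatrix (n : ℕ) : Matrix (Fin n) (Fin n) ℝ :=
  Matrix.of fun i j => if j.1 + 1 ∣ i.1 + 1 then 1 else 0

theorem det_divisorMatrix (n : ℕ) : (divisorMatrix n).det = 1 := by
  rw [Matrix.det_of_isLowerTriangular]
  · simp [divisorMatrix]
  · intro i j hij
    have hij : i < j := hij
    simp only [divisorMatrix, Matrix.of_apply, ite_eq_right_iff]
    intro h
    have := Nat.le_of_dvd (by omega) h
    omega

theorem sum_totient_dvd_eq_gcd (n : ℕ) (i j : Fin n) :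
    ∑ k : Fin n, (if k.1 + 1 ∣ i.1 + 1 ∧ k.1 + 1 ∣ j.1 + 1 then Nat.totient (k.1 + 1) else 0) =
      Nat.gcd (i.1 + 1) (j.1 + 1) := by
  rw [Fin.sum_univ_eq_sum_range
    (fun k => if k + 1 ∣ i.1 + 1 ∧ k + 1 ∣ j.1 + 1 then Nat.totient (k + 1) else 0)]
  have hle : Nat.gcd (i.1 + 1) (j.1 + 1) ≤ n :=
    (Nat.gcd_le_left _ (Nat.succ_pos _)).trans i.2
  conv_rhs => rw [← Nat.sum_totient (Nat.gcd (i.1 + 1) (j.1 + 1))]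
  rw [← Finset.sum_filter]
  refine Finset.sum_bij (fun k _ => k + 1) ?_ ?_ ?_ ?_
  · intro k hk
    simp only [Finset.mem_filter] at hk
    simp [Nat.dvd_gcd hk.2.1 hk.2.2]
  · intro a _ b _ h
    omega
  · intro d hd
    have hdvd := Nat.dvd_of_mem_divisors hd
    have hpos := Nat.pos_of_mem_divisors hd
    have hdn := (Nat.divisor_le hd).trans hle
    have hd1 : d - 1 + 1 = d := by omega
    refine ⟨d - 1, ?_, hd1⟩
    simp only [Finset.mem_filter, Finset.mem_range, hd1]
    exact ⟨by omega, hdvd.trans (Nat.gcd_dvd_left _ _), hdvd.trans (Nat.gcd_dvd_right _ _)⟩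
  · intro _ _
    rfl

theorem divisorMatrix_mul_diagonal_totient_mul_conjTranspose_apply (n : ℕ) (i j : Fin n) :
    (divisorMatrix n * Matrix.diagonal (fun k : Fin n => (Nat.totient (k.1 + 1) : ℝ)) *
      (divisorMatrix n).conjTranspose) i j = (Nat.gcd (i.1 + 1) (j.1 + 1) : ℝ) := by
  rw [← sum_totient_dvd_eq_gcd n i j, Matrix.mul_apply]
  push_cast
  refine Finset.sum_congr rfl fun k _ => ?_
  simp only [Matrix.mul_diagonal, Matrix.conjTranspose_apply, divisorMatrix, Matrix.of_apply]
  split_ifs <;> simp_all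

/-- The `n × n` GCD matrix over `ℝ`, with (1-based) entries `gcd(i,j)`,
is symmetric and positive definite. -/
theorem gcd_matrix_symm_posDef (n : ℕ) (hn : 0 < n)
    (G : Matrix (Fin n) (Fin n) ℝ)
    (hG : ∀ i j, G i j = ((Nat.gcd (i.1 + 1) (j.1 + 1) : ℕ) : ℝ)) :
    G.IsSymm ∧ G.PosDef := by
  refine ⟨Matrix.IsSymm.ext fun i j => by rw [hG, hG, Nat.gcd_comm], ?_⟩
  have hfac : G = divisorMatrix n *
      Matrix.diagonal (fun k : Fin n => (Nat.totient (k.1 + 1) : ℝ)) *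
      (divisorMatrix n).conjTranspose := by
    ext i j
    rw [hG, divisorMatrix_mul_diagonal_totient_mul_conjTranspose_apply]
  rw [hfac]
  refine Matrix.PosDef.mul_mul_conjTranspose_same
    (Matrix.PosDef.diagonal fun k => Nat.cast_pos.2 (Nat.totient_pos.2 k.1.succ_pos)) ?_
  refine Matrix.vecMul_injective_of_isUnit ((Matrix.isUnit_iff_isUnit_det _).2 ?_)
  simp [det_divisorMatrix]
end

section
/- Let n be a positive integer and let T be the n×n tridiagonal Clement matrix over ℝ, with entries T i,(i+1) = i for 1 ≤ i ≤ n−1, T (i+1),i = n − i for 1 ≤ i ≤ n−1, and all other entries zero. Then the eigenvalues of T are exactly the n numbers n−1, n−3, n−5, …, −(n−3), −(n−1); equivalently, the characteristic polynomial of T equals ∏_{k=0}^{n-1} (λ − (n − 1 − 2k)). -/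
open Polynomial in
/-- The polynomial `p = (1 + X) ^ a * (1 - X) ^ b` satisfies
`(1 - X ^ 2) p' + (a + b) X p = (a - b) p`. -/
theorem one_sub_sq_mul_derivative_add (a b : ℕ) :
    (1 - X ^ 2) * derivative ((1 + X) ^ a * (1 - X) ^ b : ℝ[X])
      + C ((a : ℝ) + b) * (X * ((1 + X) ^ a * (1 - X) ^ b))
      = C ((a : ℝ) - b) * ((1 + X) ^ a * (1 - X) ^ b) := by
  have h1 : (1 + X) * derivative ((1 + X : ℝ[X]) ^ a) = (a : ℝ[X]) * (1 + X) ^ a := by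
    cases a with
    | zero => simp
    | succ a => simp [derivative_pow]; ring
  have h2 : (1 - X) * derivative ((1 - X : ℝ[X]) ^ b) = -((b : ℝ[X]) * (1 - X) ^ b) := by
    cases b with
    | zero => simp
    | succ b => simp [derivative_pow]; ring
  rw [derivative_mul]
  simp only [map_add, map_sub, map_natCast]
  linear_combination (1 - X) * (1 - X) ^ b * h1 + (1 + X) * (1 + X) ^ a * h2

/-- A row of a tridiagonal matrix with zero diagonal, applied to the initial segment of a sequence
that vanishes at `n`. -/
theorem sum_tridiagonal_mul (n : ℕ) (c : ℕ → ℝ) (hc : c n = 0) (i : Fin n) :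
    ∑ j : Fin n, (if j.1 = i.1 + 1 then ((j.1 : ℕ) : ℝ)
      else if i.1 = j.1 + 1 then ((n - i.1 : ℕ) : ℝ) else 0) * c j
      = (i.1 + 1) * c (i.1 + 1) + if i.1 = 0 then 0 else ((n : ℝ) - i.1) * c (i.1 - 1) := by
  obtain ⟨i, hi⟩ := i
  rw [Fin.sum_univ_eq_sum_range (fun j => (if j = i + 1 then (j : ℝ)
      else if i = j + 1 then ((n - i : ℕ) : ℝ) else 0) * c j) n]
  have key : ∀ j ∈ Finset.range n, (if j = i + 1 then (j : ℝ)
      else if i = j + 1 then ((n - i : ℕ) : ℝ) else 0) * c j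
      = (if i + 1 = j then (j : ℝ) * c j else 0)
        + if i - 1 = j then (if i = 0 then 0 else ((n : ℝ) - i) * c j) else 0 := by
    intro j _
    rw [Nat.cast_sub hi.le]
    split_ifs <;> first | omega | simp
  rw [Finset.sum_congr rfl key, Finset.sum_add_distrib, Finset.sum_ite_eq, Finset.sum_ite_eq]
  have h : i - 1 < n := by omega
  rcases Nat.lt_or_ge (i + 1) n with h' | h'
  · simp [h, h']
  · obtain rfl : n = i + 1 := by omega
    simp [hc]

open Polynomial in
/-- The coefficients of `(1 + X) ^ a * (1 - X) ^ b` form an eigenvector of the Clement matrix of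
size `a + b + 1` for the eigenvalue `a - b`. -/
theorem sum_clement_mul_coeff (a b : ℕ) (i : Fin (a + b + 1)) :
    ∑ j : Fin (a + b + 1), (if j.1 = i.1 + 1 then ((j.1 : ℕ) : ℝ)
      else if i.1 = j.1 + 1 then ((a + b + 1 - i.1 : ℕ) : ℝ) else 0)
        * ((1 + X) ^ a * (1 - X) ^ b : ℝ[X]).coeff j
      = ((a : ℝ) - b) * ((1 + X) ^ a * (1 - X) ^ b : ℝ[X]).coeff i := by
  have hdeg : ((1 + X) ^ a * (1 - X) ^ b : ℝ[X]).natDegree ≤ a + b := by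
    compute_degree
  have hode := congrArg (fun q => coeff q i.1) (one_sub_sq_mul_derivative_add a b)
  generalize ((1 + X) ^ a * (1 - X) ^ b : ℝ[X]) = p at *
  rw [sum_tridiagonal_mul _ p.coeff (coeff_eq_zero_of_natDegree_lt (by omega))]
  obtain ⟨i, hi⟩ := i
  simp only [coeff_C_mul, coeff_add, sub_mul, one_mul, coeff_sub] at hode ⊢
  rw [← hode]
  rcases i with _ | _ | i
  · simp [coeff_derivative, mul_comm]
  · simp [coeff_derivative, coeff_X_pow_mul', coeff_X_mul]
    ring
  · simp [coeff_derivative, coeff_X_pow_mul', coeff_X_mul]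
    ring

open Polynomial in
/-- The eigenvalues of the `n × n` Clement tridiagonal matrix (zero diagonal,
superdiagonal entries `i`, subdiagonal entries `n - i`, 1-based) are exactly
`n-1, n-3, …, -(n-1)`; equivalently its characteristic polynomial is
`∏_{k=0}^{n-1} (λ - (n - 1 - 2k))`. -/
theorem clement_charpoly (n : ℕ) (hn : 0 < n)
    (T : Matrix (Fin n) (Fin n) ℝ)
    (hT : ∀ i j, T i j =
      if j.1 = i.1 + 1 then ((j.1 : ℕ) : ℝ)
      else if i.1 = j.1 + 1 then ((n - i.1 : ℕ) : ℝ)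
      else 0) :
    T.charpoly = ∏ k : Fin n, (X - C ((n : ℝ) - 1 - 2 * (k.1 : ℝ))) := by
  have hroot : ∀ k : Fin n, T.charpoly.IsRoot ((n : ℝ) - 1 - 2 * (k.1 : ℝ)) := by
    rintro ⟨k, hk⟩
    obtain ⟨a, rfl⟩ : ∃ a, n = a + k + 1 := ⟨n - k - 1, by omega⟩
    rw [IsRoot, Matrix.eval_charpoly, ← Matrix.exists_mulVec_eq_zero_iff]
    refine ⟨fun j => ((1 + X) ^ a * (1 - X) ^ k : ℝ[X]).coeff j, fun h => ?_, ?_⟩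
    · simpa [coeff_zero_eq_eval_zero] using congrFun h 0
    · ext i
      have := sum_clement_mul_coeff a k i
      simp only [← hT] at this
      simp only [Matrix.sub_mulVec, Pi.sub_apply, Matrix.scalar_apply, Matrix.mulVec_diagonal,
        Pi.zero_apply]
      rw [Matrix.mulVec, dotProduct, this]
      push_cast
      ring
  have hinj : Function.Injective fun k : Fin n => (n : ℝ) - 1 - 2 * (k.1 : ℝ) := by
    intro k l h
    simpa [Fin.ext_iff] using h
  have hdvd : ∏ k : Fin n, (X - C ((n : ℝ) - 1 - 2 * (k.1 : ℝ))) ∣ T.charpoly :=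
    Finset.prod_dvd_of_coprime
      (fun k _ l _ hkl => pairwise_coprime_X_sub_C hinj hkl)
      (fun k _ => dvd_iff_isRoot.mpr (hroot k))
  refine eq_of_monic_of_dvd_of_natDegree_le
    (monic_prod_of_monic _ _ fun k _ => monic_X_sub_C _) T.charpoly_monic hdvd ?_
  rw [natDegree_prod_of_monic _ _ fun k _ => monic_X_sub_C _]
  simp only [natDegree_X_sub_C, Matrix.charpoly_natDegree_eq_dim]
  simp
end

section
/- Let n be a positive integer and let A be the n×n Minij matrix over ℝ, with entries A i j = min(i, j). Then A⁻¹ is the symmetric tridiagonal matrix B with B i i = 2 for 1 ≤ i ≤ n−1, B n n = 1, B i j = −1 for |i − j| = 1, and B i j = 0 otherwise; that is, A · B = I. -/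
/-- Pairing the `j`-th column of the tridiagonal matrix with the values `f 1, …, f n` of a function
vanishing at `0`. -/
theorem sum_range_mul_tridiagonal (n : ℕ) (f : ℕ → ℝ) (hf : f 0 = 0) {j : ℕ} (hj : j < n) :
    ∑ k ∈ Finset.range n, f (k + 1) *
      (if k = j then (if k = n - 1 then 1 else 2)
        else if ((k : ℤ) - (j : ℤ)).natAbs = 1 then -1 else 0) =
      if j = n - 1 then f (j + 1) - f j else 2 * f (j + 1) - f j - f (j + 2) := by
  have split_entry : ∀ k, f (k + 1) *
      (if k = j then (if k = n - 1 then 1 else 2)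
        else if ((k : ℤ) - (j : ℤ)).natAbs = 1 then -1 else 0) =
      (if k = j then f (j + 1) * (if j = n - 1 then 1 else 2) else 0)
        - (if k + 1 = j then f j else 0) - (if k = j + 1 then f (j + 2) else 0) := by
    intro k
    rcases eq_or_ne k j with rfl | hkj
    · simp
    rcases eq_or_ne (k + 1) j with rfl | hkj'
    · simp [show k ≠ k + 1 + 1 by lia]
    rcases eq_or_ne k (j + 1) with rfl | hkj''
    · simp [show j + 1 + 1 ≠ j by lia]
    · simp [hkj, hkj', hkj'', show ((k : ℤ) - (j : ℤ)).natAbs ≠ 1 by lia]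
  have lower : ∑ k ∈ Finset.range n, (if k + 1 = j then f j else 0) = f j := by
    cases j with
    | zero => simp [hf]
    | succ m => simp [show m < n by lia]
  simp only [split_entry, Finset.sum_sub_distrib, lower, Finset.sum_ite_eq', Finset.mem_range,
    hj, if_true]
  by_cases h : j = n - 1
  · simp [h, show ¬ n - 1 + 1 < n by lia]
  · simp [h, show j + 1 < n by lia]
    ring


/-- The inverse of the `n × n` Minij matrix `A i j = min(i,j)` is the symmetric
tridiagonal matrix `B` with diagonal entries `2` (except the last, which is `1`)
and sub/superdiagonal entries `-1`; that is, `A · B = I` and `A⁻¹ = B`. -/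
theorem minij_inverse (n : ℕ) (hn : 0 < n)
    (A B : Matrix (Fin n) (Fin n) ℝ)
    (hA : ∀ i j, A i j = ((min (i.1 + 1) (j.1 + 1) : ℕ) : ℝ))
    (hB : ∀ i j, B i j =
      if i = j then (if i.1 = n - 1 then 1 else 2)
      else if ((i.1 : ℤ) - (j.1 : ℤ)).natAbs = 1 then -1 else 0) :
    A * B = 1 ∧ A⁻¹ = B := by
  have hAB : A * B = 1 := by
    ext i j
    rw [Matrix.mul_apply]
    simp only [hA, hB, Fin.ext_iff]
    rw [Fin.sum_univ_eq_sum_range (fun k => ((min (i.1 + 1) (k + 1) : ℕ) : ℝ) *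
      (if k = j.1 then (if k = n - 1 then 1 else 2)
        else if ((k : ℤ) - (j.1 : ℤ)).natAbs = 1 then -1 else 0)) n,
      sum_range_mul_tridiagonal n (fun k => ((min (i.1 + 1) k : ℕ) : ℝ)) (by simp) j.2]
    have hi := i.2
    have hj := j.2
    simp only [Matrix.one_apply, Fin.ext_iff]
    rcases lt_trichotomy i.1 j.1 with hij | hij | hij
    · rw [min_eq_left (by lia), min_eq_left (by lia), min_eq_left (by lia), if_neg hij.ne]
      split_ifs <;> ring
    · rw [min_eq_right (by lia), min_eq_right (by lia), min_eq_left (by lia), if_pos hij, hij]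
      push_cast
      split_ifs <;> ring
    · rw [min_eq_right (by lia), min_eq_right (by lia), min_eq_right (by lia), if_neg hij.ne',
        if_neg (by lia)]
      push_cast
      ring
  exact ⟨hAB, Matrix.inv_eq_right_inv hAB⟩
end
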